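/- arXiv:1711.01729 — 4 statements merged into one kernel-verified Lean document; each statement's English description precedes it below -/
import Mathlib

section
/- Let d, g, r be integers with r ≥ 5 such that (2r - 3)d - (r - 2)²g - 2r² + 3r - 9 ≥ 0, 2d ≤ (2r - 4)g - r + 2, and g ≥ 5 if r ∈ {5, 6} while g ≥ 4 if r ≥ 7. Then there exists an integer t satisfying all of the following: t ≥ 2; (r, t) ∉ {(5, 2), (6, 2)}; g ≥ 2t - 1; d ≥ g + r + 2 + (r - 5)t; the triple (d - (r - 3)t, g - 2t, r) is not equal to (8, 1, 5); 2d - (2r - 4)g + (2r - 2)t ≥ r + 1; and d ≥ (r - 2)t + 1. -/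
/-- The least integer `t` with `a ≤ b * t`, for `b` positive. -/
theorem exists_int_ceil_div (a : ℤ) {b : ℤ} (hb : 0 < b) :
    ∃ t : ℤ, a ≤ b * t ∧ b * (t - 1) < a := by
  refine ⟨-(-a / b), ?_, ?_⟩
  · linarith [Int.mul_ediv_self_le (x := -a) hb.ne']
  · linarith [Int.lt_mul_ediv_self_add (x := -a) hb]

theorem stmt_0 (d g r : ℤ) (hr : 5 ≤ r)
    (h1 : (2*r - 3)*d - (r - 2)^2*g - 2*r^2 + 3*r - 9 ≥ 0)
    (h2 : 2*d ≤ (2*r - 4)*g - r + 2)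
    (h3 : (r = 5 ∨ r = 6) → 5 ≤ g)
    (h4 : 7 ≤ r → 4 ≤ g) :
    ∃ t : ℤ,
      2 ≤ t ∧
      ¬((r = 5 ∧ t = 2) ∨ (r = 6 ∧ t = 2)) ∧
      g ≥ 2*t - 1 ∧
      d ≥ g + r + 2 + (r - 5)*t ∧
      ¬(d - (r - 3)*t = 8 ∧ g - 2*t = 1 ∧ r = 5) ∧
      2*d - (2*r - 4)*g + (2*r - 2)*t ≥ r + 1 ∧
      d ≥ (r - 2)*t + 1 := by
  obtain ⟨t, ht, ht'⟩ := exists_int_ceil_div (r + 1 + (2*r - 4)*g - 2*d)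
    (show 0 < 2*r - 2 by lia)
  obtain rfl | rfl | hr7 : r = 5 ∨ r = 6 ∨ 7 ≤ r := by lia
  · exact ⟨max 3 t, by omega⟩
  · exact ⟨max 3 t, by omega⟩
  have hg := h4 hr7
  have ht2 : 2 ≤ t := by
    by_contra! h
    nlinarith
  -- Writing `4 (r - 2)² = (2r - 5)(2r - 3) + 1` turns `h1` into a bound on `4 d`.
  have hd : (2*r - 5)*g + 4*r < 4*d := by
    by_contra! h
    nlinarith [mul_le_mul_of_nonneg_left h (show 0 ≤ 2*r - 3 by lia)]
  have htg : 2*t ≤ g := by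
    by_contra! h
    nlinarith [mul_le_mul_of_nonneg_left (show g + 1 ≤ 2*t by lia) (show 0 ≤ 2*r - 2 by lia)]
  refine ⟨t, ht2, by lia, by lia, ?_, by lia, by linarith, ?_⟩
  · obtain h | h : 2*t = g ∨ 2*t + 1 ≤ g := by lia
    · subst h
      obtain rfl | rfl | h8 : t = 2 ∨ t = 3 ∨ 4 ≤ t := by lia
      · lia
      · lia
      · nlinarith
    · nlinarith [mul_le_mul_of_nonneg_left h (show 0 ≤ 2*r - 10 by lia)]
  · by_contra! h
    have h' : (2*r - 2)*d ≤ (2*r - 2)*((r - 2)*t) :=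
      mul_le_mul_of_nonneg_left (by lia) (by lia)
    have h'' := mul_le_mul_of_nonneg_left (Int.add_one_le_iff.mpr ht') (show 0 ≤ r - 2 by lia)
    nlinarith
end

section
/- Let d, g, r be integers with r ≥ 5, and set s = ⌈((2r - 4)g - 2d + r + 1)/(2r - 2)⌉ (the ceiling of the rational number). If (2r - 3)d - (r - 2)²g - 2r² + 3r - 9 ≥ 0, then (r - 2)(s + 1) ≤ d - 1 when r ∈ {5, 6}, and (r - 2)s ≤ d - 1 when r ≥ 7. -/
/-- A ceiling of a quotient of integers exceeds the quotient by less than one. -/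
theorem mul_ceil_div_lt_add {a b : ℤ} (hb : 0 < b) : b * ⌈(a : ℚ) / b⌉ < a + b := by
  have hb' : (0 : ℚ) < b := by exact_mod_cast hb
  have hlt := mul_lt_mul_of_pos_left (Int.ceil_lt_add_one ((a : ℚ) / b)) hb'
  rw [mul_add, mul_div_cancel₀ _ hb'.ne', mul_one] at hlt
  exact_mod_cast hlt

theorem stmt_4 (d g r : ℤ) (hr : 5 ≤ r)
    (s : ℤ)
    (hs : s = ⌈((2*(r:ℚ) - 4)*(g:ℚ) - 2*(d:ℚ) + (r:ℚ) + 1) / (2*(r:ℚ) - 2)⌉)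
    (h : (2*r - 3)*d - (r - 2)^2*g - 2*r^2 + 3*r - 9 ≥ 0) :
    ((r = 5 ∨ r = 6) → (r - 2)*(s + 1) ≤ d - 1) ∧ (7 ≤ r → (r - 2)*s ≤ d - 1) := by
  have hceil := mul_ceil_div_lt_add (a := (2*r - 4)*g - 2*d + r + 1) (b := 2*r - 2) (by linarith)
  push_cast at hceil
  rw [← hs] at hceil
  have hbound : (2*r - 2)*((r - 2)*s) ≤ (2*r - 2)*d - r^2 - 2*r - 14 := by
    have hmul := mul_le_mul_of_nonneg_left (Int.le_sub_one_of_lt hceil)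
      (by linarith : (0 : ℤ) ≤ r - 2)
    linarith
  constructor
  · rintro (rfl | rfl) <;> linarith
  · intro _
    refine le_of_mul_le_mul_left (a := 2*r - 2) ?_ (by linarith)
    linarith [sq_nonneg r]
end

section
/- Let r and n be integers with r ≥ 5 and 0 ≤ n ≤ 2r - 7, and set a = ⌈(r - 2)/2⌉. Then (2r - 3)n - (r - 2)²·⌊n/a⌋ ≤ r² - 3. -/
theorem stmt_8 (r n : ℤ) (hr : 5 ≤ r) (hn0 : 0 ≤ n) (hn : n ≤ 2*r - 7)
    (a : ℤ) (ha : a = ⌈((r:ℚ) - 2) / 2⌉) :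
    (2*r - 3)*n - (r - 2)^2 * ⌊(n:ℚ) / (a:ℚ)⌋ ≤ r^2 - 3 := by
  obtain ⟨h1, h2⟩ := Int.ceil_eq_iff.mp ha.symm
  have h3 : 2 * a - 2 < r - 2 := by
    have : 2 * (a:ℚ) - 2 < r - 2 := by linarith
    exact_mod_cast this
  have h4 : r - 2 ≤ 2 * a := by
    have : (r:ℚ) - 2 ≤ 2 * a := by linarith
    exact_mod_cast this
  have ha2 : 2 ≤ a := by omega
  have ha0 : (0:ℚ) < a := by exact_mod_cast (by omega : 0 < a)
  obtain ⟨q, hq⟩ : ∃ q, q = ⌊(n:ℚ) / (a:ℚ)⌋ := ⟨_, rfl⟩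
  rw [← hq]
  obtain ⟨h5, h6⟩ := Int.floor_eq_iff.mp hq.symm
  rw [le_div_iff₀ ha0] at h5
  rw [div_lt_iff₀ ha0] at h6
  have h7 : q * a ≤ n := by exact_mod_cast h5
  have h8 : n < (q + 1) * a := by exact_mod_cast h6
  have hq0 : 0 ≤ q := by
    by_contra! h
    nlinarith
  have hq3 : q ≤ 3 := by
    by_contra! h
    nlinarith
  have h9 : n ≤ (q + 1) * a - 1 := by omega
  have h10 : (2*r - 3) * n ≤ (2*r - 3) * ((q + 1) * a - 1) :=
    mul_le_mul_of_nonneg_left h9 (by omega)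
  rcases (by omega : r = 2 * a + 2 ∨ r = 2 * a + 1) with rfl | rfl <;>
    interval_cases q <;> nlinarith
end

section
/- Let r and n be integers with r ≥ 5 and 0 ≤ n ≤ 2r - 7, and set a = ⌈(r - 2)/2⌉. Then 10r² - 62r + 73 ≥ (2r - 3)n - (r - 2)²·⌊n/a⌋. -/
theorem stmt_9 (r n : ℤ) (hr : 5 ≤ r) (hn0 : 0 ≤ n) (hn : n ≤ 2*r - 7)
    (a : ℤ) (ha : a = ⌈((r:ℚ) - 2) / 2⌉) :
    10*r^2 - 62*r + 73 ≥ (2*r - 3)*n - (r - 2)^2 * ⌊(n:ℚ) / (a:ℚ)⌋ := by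
  have h_lower : r - 2 ≤ 2 * a := by
    have h := Int.le_ceil (((r:ℚ) - 2) / 2)
    rw [← ha] at h
    have h' : (r:ℚ) - 2 ≤ 2 * a := by linarith
    exact_mod_cast h'
  have h_upper : 2 * a ≤ r - 1 := by
    have h := Int.ceil_lt_add_one (((r:ℚ) - 2) / 2)
    rw [← ha] at h
    have h' : 2 * (a:ℚ) < r := by linarith
    have : 2 * a < r := by exact_mod_cast h'
    omega
  have ha_pos : 0 < a := by omega
  have ha_rat : (0:ℚ) < a := by exact_mod_cast ha_pos
  have hn_lt : n < (⌊(n:ℚ) / (a:ℚ)⌋ + 1) * a := by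
    have h := Int.lt_floor_add_one ((n:ℚ) / (a:ℚ))
    rw [div_lt_iff₀ ha_rat] at h
    exact_mod_cast h
  have hk : 0 ≤ ⌊(n:ℚ) / (a:ℚ)⌋ := Int.floor_nonneg.mpr (by positivity)
  generalize ⌊(n:ℚ) / (a:ℚ)⌋ = k at *
  have hk_cases : k = 0 ∨ k = 1 ∨ 2 ≤ k := by omega
  rcases hk_cases with rfl | rfl | hk2
  · have hb : 2 * n ≤ r - 3 := by omega
    nlinarith
  · have hb : n ≤ r - 2 := by omega
    nlinarith
  · have h1 : (2*r - 3) * n ≤ (2*r - 3) * (2*r - 7) :=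
      mul_le_mul_of_nonneg_left hn (by omega)
    have h2 : (r - 2)^2 * 2 ≤ (r - 2)^2 * k :=
      mul_le_mul_of_nonneg_left hk2 (sq_nonneg _)
    nlinarith
end
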